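/- Let f : ℝ × ℝ → ℝ be C^∞ and let u be a C^∞ solution of u'(t) = f(t, u(t)) on [a,b]. Fix t ∈ [a,b), write f, f_t, f_u, f_tt, f_tu, f_uu for f and its partial derivatives evaluated at (t, u(t)) and write v = u(t). Take the three-stage IMQ-RBF Runge–Kutta method with a₂₁ = c₂ = 1, a₃₁ = 1/4, a₃₂ = 1/4, c₃ = 1/2, b₁ = 1/6, b₂ = 1/6, b₃ = 2/3, and shape parameters ε₂² = (−f·f_t·f_uu − f·f_u³ + f·f_u·f_tu − f_t·f_u² − f_t·f_tu + f_tt·f_u)/(v·f·f_uu + 2v·f_u² + v·f_tu − f·f_u) and ε₃² = −ε₂², assuming the denominator v·f·f_uu + 2v·f_u² + v·f_tu − f·f_u is nonzero. Then the local truncation error τ(t,h) satisfies τ(t,h) = O(h⁴) as h → 0⁺; that is, there exist C > 0 and h₀ > 0 such that |τ(t,h)| ≤ C h⁴ for all 0 < h ≤ h₀ (so the method is fourth-order accurate). -/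

import Mathlib

/-- Directional (partial) derivative of `f : ℝ × ℝ → ℝ` in the direction `d`;
`pd f (1,0) = f_t`, `pd f (0,1) = f_u`, and iterates give higher partials. -/
noncomputable def pd (f : ℝ × ℝ → ℝ) (d : ℝ × ℝ) : ℝ × ℝ → ℝ :=
  fun p => fderiv ℝ f p d

open Filter Topology Asymptotics

/-- The derivative of a differentiable function on the plane in terms of its partials. -/
lemma hasFDerivAt_pd {g : ℝ × ℝ → ℝ} (hg : Differentiable ℝ g) (z : ℝ × ℝ) :
    HasFDerivAt g (pd g (1, 0) z • ContinuousLinearMap.fst ℝ ℝ ℝ +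
      pd g (0, 1) z • ContinuousLinearMap.snd ℝ ℝ ℝ) z := by
  have h := (hg z).hasFDerivAt
  convert h using 1
  ext <;> simp [pd]

lemma contDiff_pd {g : ℝ × ℝ → ℝ} (hg : ContDiff ℝ (⊤ : ℕ∞) g) (d : ℝ × ℝ) :
    ContDiff ℝ (⊤ : ℕ∞) (pd g d) :=
  (hg.fderiv_right (m := (⊤ : ℕ∞)) (by simp)).clm_apply contDiff_const

/-- Iterated directional derivatives of a smooth function commute. -/
lemma pd_comm {g : ℝ × ℝ → ℝ} (hg : ContDiff ℝ (⊤ : ℕ∞) g) (d e : ℝ × ℝ) :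
    pd (pd g d) e = pd (pd g e) d := by
  have key : ∀ d e z, pd (pd g d) e z = fderiv ℝ (fderiv ℝ g) z e d := by
    intro d e z
    have hd : DifferentiableAt ℝ (fderiv ℝ g) z :=
      (hg.fderiv_right (m := (⊤ : ℕ∞)) (by simp)).differentiable (by simp) z
    change fderiv ℝ (fun p => fderiv ℝ g p d) z e = _
    rw [fderiv_clm_apply hd (differentiableAt_const d)]
    simp
  funext z
  rw [key, key]
  exact (hg.contDiffAt.isSymmSndFDerivAt (by
    rw [minSmoothness_of_isRCLikeNormedField]
    exact WithTop.coe_le_coe.2 (le_top : (2 : ℕ∞) ≤ ⊤))) e d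

/-- If the partials of `g` are approximated to order `n` at `p` by those of `Q`, and the values at
`p` agree, then `Q` approximates `g` to order `n + 1`. -/
lemma isBigO_sub_of_partials {g Q Q₁ Q₂ : ℝ × ℝ → ℝ} {p : ℝ × ℝ} {n : ℕ}
    (hg : Differentiable ℝ g)
    (hQ : ∀ z, HasFDerivAt Q (Q₁ z • ContinuousLinearMap.fst ℝ ℝ ℝ +
      Q₂ z • ContinuousLinearMap.snd ℝ ℝ ℝ) z)
    (h₁ : (fun z => pd g (1, 0) z - Q₁ z) =O[𝓝 p] fun z => ‖z - p‖ ^ n)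
    (h₂ : (fun z => pd g (0, 1) z - Q₂ z) =O[𝓝 p] fun z => ‖z - p‖ ^ n)
    (hp : g p = Q p) :
    (fun z => g z - Q z) =O[𝓝 p] fun z => ‖z - p‖ ^ (n + 1) := by
  obtain ⟨C₁, hC₁, h₁⟩ := h₁.exists_pos
  obtain ⟨C₂, hC₂, h₂⟩ := h₂.exists_pos
  obtain ⟨r, hr, hball⟩ := Metric.eventually_nhds_iff_ball.1 (h₁.bound.and h₂.bound)
  refine IsBigO.of_bound (C₁ + C₂) ?_
  filter_upwards [Metric.ball_mem_nhds p hr] with z hz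
  have hz' : ‖z - p‖ < r := by simpa [dist_eq_norm] using hz
  have hder : ∀ w ∈ Metric.closedBall p ‖z - p‖, HasFDerivWithinAt (fun z => g z - Q z)
      ((pd g (1, 0) w - Q₁ w) • ContinuousLinearMap.fst ℝ ℝ ℝ +
        (pd g (0, 1) w - Q₂ w) • ContinuousLinearMap.snd ℝ ℝ ℝ)
      (Metric.closedBall p ‖z - p‖) w := by
    intro w _
    refine (((hasFDerivAt_pd hg w).sub (hQ w)).congr_fderiv ?_).hasFDerivWithinAt
    module
  have hbound : ∀ w ∈ Metric.closedBall p ‖z - p‖,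
      ‖(pd g (1, 0) w - Q₁ w) • ContinuousLinearMap.fst ℝ ℝ ℝ +
        (pd g (0, 1) w - Q₂ w) • ContinuousLinearMap.snd ℝ ℝ ℝ‖ ≤
      (C₁ + C₂) * ‖z - p‖ ^ n := by
    intro w hw
    have hwp : ‖w - p‖ ≤ ‖z - p‖ := by simpa [dist_eq_norm] using hw
    obtain ⟨b₁, b₂⟩ := hball w (by simpa [dist_eq_norm] using hwp.trans_lt hz')
    rw [norm_pow, norm_norm] at b₁ b₂
    have hpow : ‖w - p‖ ^ n ≤ ‖z - p‖ ^ n := by gcongr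
    calc _ ≤ ‖pd g (1, 0) w - Q₁ w‖ * ‖ContinuousLinearMap.fst ℝ ℝ ℝ‖ +
          ‖pd g (0, 1) w - Q₂ w‖ * ‖ContinuousLinearMap.snd ℝ ℝ ℝ‖ := by
          refine (norm_add_le _ _).trans (le_of_eq ?_)
          rw [norm_smul, norm_smul]
      _ ≤ (C₁ * ‖z - p‖ ^ n) * 1 + (C₂ * ‖z - p‖ ^ n) * 1 := by
          gcongr
          · exact b₁.trans (by gcongr)
          · exact ContinuousLinearMap.norm_fst_le ..
          · exact b₂.trans (by gcongr)
          · exact ContinuousLinearMap.norm_snd_le ..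
      _ = _ := by ring
  have := (convex_closedBall p ‖z - p‖).norm_image_sub_le_of_norm_hasFDerivWithin_le hder hbound
    (Metric.mem_closedBall_self (norm_nonneg _)) (y := z) (by simp [dist_eq_norm])
  simp only [hp, sub_self, sub_zero] at this
  rw [norm_pow, norm_norm, pow_succ]
  linarith

lemma isBigO_sub_taylor_zero {g : ℝ × ℝ → ℝ} (hg : ContDiff ℝ (⊤ : ℕ∞) g) (p : ℝ × ℝ) :
    (fun z => g z - g p) =O[𝓝 p] fun z => ‖z - p‖ ^ 1 := by
  simpa using ((hg.differentiable (by simp)) p).isBigO_sub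

lemma hasFDerivAt_fst_sub (p z : ℝ × ℝ) :
    HasFDerivAt (fun z : ℝ × ℝ => z.1 - p.1) (ContinuousLinearMap.fst ℝ ℝ ℝ) z :=
  hasFDerivAt_fst.sub_const _

lemma hasFDerivAt_snd_sub (p z : ℝ × ℝ) :
    HasFDerivAt (fun z : ℝ × ℝ => z.2 - p.2) (ContinuousLinearMap.snd ℝ ℝ ℝ) z :=
  hasFDerivAt_snd.sub_const _

lemma isBigO_sub_taylor_one {g : ℝ × ℝ → ℝ} (hg : ContDiff ℝ (⊤ : ℕ∞) g) (p : ℝ × ℝ) :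
    (fun z => g z - (g p + pd g (1, 0) p * (z.1 - p.1) + pd g (0, 1) p * (z.2 - p.2)))
      =O[𝓝 p] fun z => ‖z - p‖ ^ 2 := by
  refine isBigO_sub_of_partials (hg.differentiable (by simp)) (fun z => ?_)
    (isBigO_sub_taylor_zero (contDiff_pd hg _) p)
    (isBigO_sub_taylor_zero (contDiff_pd hg _) p) (by simp)
  exact (((hasFDerivAt_fst_sub p z).const_mul _).const_add _).add
    ((hasFDerivAt_snd_sub p z).const_mul _)

lemma isBigO_sub_taylor_two {g : ℝ × ℝ → ℝ} (hg : ContDiff ℝ (⊤ : ℕ∞) g) (p : ℝ × ℝ) :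
    (fun z => g z - (g p + pd g (1, 0) p * (z.1 - p.1) + pd g (0, 1) p * (z.2 - p.2) +
        (pd (pd g (1, 0)) (1, 0) p * (z.1 - p.1) ^ 2 +
          2 * pd (pd g (1, 0)) (0, 1) p * ((z.1 - p.1) * (z.2 - p.2)) +
          pd (pd g (0, 1)) (0, 1) p * (z.2 - p.2) ^ 2) / 2))
      =O[𝓝 p] fun z => ‖z - p‖ ^ 3 := by
  refine isBigO_sub_of_partials (hg.differentiable (by simp)) (fun z => ?_)
    (isBigO_sub_taylor_one (contDiff_pd hg _) p)
    (isBigO_sub_taylor_one (contDiff_pd hg _) p) (by simp)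
  have hx := hasFDerivAt_fst_sub p z
  have hy := hasFDerivAt_snd_sub p z
  refine (((((hx.const_mul _).const_add _).add (hy.const_mul _)).add
    (((((hx.pow 2).const_mul _).add ((hx.mul hy).const_mul _)).add
      ((hy.pow 2).const_mul _)).mul_const (2⁻¹ : ℝ)))).congr_fderiv ?_
  rw [pd_comm hg (0, 1) (1, 0)]
  ext <;> simp <;> ring

lemma isBigO_sub_taylor_three {g : ℝ × ℝ → ℝ} (hg : ContDiff ℝ (⊤ : ℕ∞) g) (p : ℝ × ℝ) :
    (fun z => g z - (g p + pd g (1, 0) p * (z.1 - p.1) + pd g (0, 1) p * (z.2 - p.2) +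
        (pd (pd g (1, 0)) (1, 0) p * (z.1 - p.1) ^ 2 +
          2 * pd (pd g (1, 0)) (0, 1) p * ((z.1 - p.1) * (z.2 - p.2)) +
          pd (pd g (0, 1)) (0, 1) p * (z.2 - p.2) ^ 2) / 2 +
        (pd (pd (pd g (1, 0)) (1, 0)) (1, 0) p * (z.1 - p.1) ^ 3 +
          3 * pd (pd (pd g (1, 0)) (1, 0)) (0, 1) p * ((z.1 - p.1) ^ 2 * (z.2 - p.2)) +
          3 * pd (pd (pd g (1, 0)) (0, 1)) (0, 1) p * ((z.1 - p.1) * (z.2 - p.2) ^ 2) +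
          pd (pd (pd g (0, 1)) (0, 1)) (0, 1) p * (z.2 - p.2) ^ 3) / 6))
      =O[𝓝 p] fun z => ‖z - p‖ ^ 4 := by
  refine isBigO_sub_of_partials (hg.differentiable (by simp)) (fun z => ?_)
    (isBigO_sub_taylor_two (contDiff_pd hg _) p)
    (isBigO_sub_taylor_two (contDiff_pd hg _) p) (by simp)
  have hx := hasFDerivAt_fst_sub p z
  have hy := hasFDerivAt_snd_sub p z
  refine (((((hx.const_mul _).const_add _).add (hy.const_mul _)).add
    (((((hx.pow 2).const_mul _).add ((hx.mul hy).const_mul _)).add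
      ((hy.pow 2).const_mul _)).mul_const (2⁻¹ : ℝ))).add
    ((((((hx.pow 3).const_mul _).add (((hx.pow 2).mul hy).const_mul _)).add
      ((hx.mul (hy.pow 2)).const_mul _)).add
      ((hy.pow 3).const_mul _)).mul_const (6⁻¹ : ℝ))).congr_fderiv ?_
  rw [pd_comm hg (0, 1) (1, 0), pd_comm (contDiff_pd hg (1, 0)) (0, 1) (1, 0)]
  rw [pd_comm (contDiff_pd hg (1, 0)) (1, 0) (0, 1)]
  ext <;> simp <;> ring

/-- `RightJet n g c₀ c₁ c₂ c₃` says that `g h = c₀ + c₁ h + c₂ h² + c₃ h³ + O(hⁿ)` as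
`h → 0⁺`. -/
def RightJet (n : ℕ) (g : ℝ → ℝ) (c₀ c₁ c₂ c₃ : ℝ) : Prop :=
  (fun h => g h - (c₀ + c₁ * h + c₂ * h ^ 2 + c₃ * h ^ 3)) =O[𝓝[>] 0] fun h : ℝ => h ^ n

lemma isBigO_pow_nhdsGT_zero {m n : ℕ} (h : m ≤ n) :
    (fun x : ℝ => x ^ n) =O[𝓝[>] 0] fun x : ℝ => x ^ m :=
  IsBigO.of_bound 1 <| by
    filter_upwards [Ioo_mem_nhdsGT one_pos] with x ⟨hx₀, hx₁⟩
    rw [one_mul, norm_pow, norm_pow, Real.norm_of_nonneg hx₀.le]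
    exact pow_le_pow_of_le_one hx₀.le hx₁.le h

namespace RightJet

variable {n : ℕ} {g k : ℝ → ℝ} {a₀ a₁ a₂ a₃ b₀ b₁ b₂ b₃ : ℝ}

lemma congr_fun (hg : RightJet n g a₀ a₁ a₂ a₃) (h : ∀ᶠ x in 𝓝[>] 0, g x = k x) :
    RightJet n k a₀ a₁ a₂ a₃ := by
  refine IsBigO.congr' hg ?_ EventuallyEq.rfl
  filter_upwards [h] with x hx
  rw [hx]

lemma congr_coeff (hg : RightJet n g a₀ a₁ a₂ a₃) (h₀ : a₀ = b₀) (h₁ : a₁ = b₁)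
    (h₂ : a₂ = b₂) (h₃ : a₃ = b₃) : RightJet n g b₀ b₁ b₂ b₃ := by
  subst h₀ h₁ h₂ h₃
  exact hg

lemma congr_of_le (hg : RightJet n g a₀ a₁ a₂ a₃) (h₁ : n ≤ 1 ∨ a₁ = b₁)
    (h₂ : n ≤ 2 ∨ a₂ = b₂) (h₃ : n ≤ 3 ∨ a₃ = b₃) : RightJet n g a₀ b₁ b₂ b₃ := by
  have key : ∀ {m : ℕ} {a b : ℝ}, (n ≤ m ∨ a = b) →
      (fun x : ℝ => (a - b) * x ^ m) =O[𝓝[>] 0] fun x : ℝ => x ^ n := by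
    rintro m a b (h | rfl)
    · exact (isBigO_pow_nhdsGT_zero h).const_mul_left _
    · simpa using isBigO_zero _ _
  refine (((IsBigO.add hg (key h₁)).add (key h₂)).add (key h₃)).congr_left fun x => ?_
  ring

lemma poly (n : ℕ) (c₀ c₁ c₂ c₃ : ℝ) :
    RightJet n (fun h => c₀ + c₁ * h + c₂ * h ^ 2 + c₃ * h ^ 3) c₀ c₁ c₂ c₃ := by
  simpa [RightJet] using isBigO_zero _ _

lemma const (n : ℕ) (c : ℝ) : RightJet n (fun _ => c) c 0 0 0 :=
  (poly n c 0 0 0).congr_fun (.of_forall fun x => by ring)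

lemma linear (n : ℕ) (c : ℝ) : RightJet n (fun h => c * h) 0 c 0 0 :=
  (poly n 0 c 0 0).congr_fun (.of_forall fun x => by ring)

lemma add (hg : RightJet n g a₀ a₁ a₂ a₃) (hk : RightJet n k b₀ b₁ b₂ b₃) :
    RightJet n (fun h => g h + k h) (a₀ + b₀) (a₁ + b₁) (a₂ + b₂) (a₃ + b₃) :=
  (IsBigO.add hg hk).congr_left fun x => by ring

lemma const_mul (hg : RightJet n g a₀ a₁ a₂ a₃) (c : ℝ) :
    RightJet n (fun h => c * g h) (c * a₀) (c * a₁) (c * a₂) (c * a₃) :=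
  (IsBigO.const_mul_left hg c).congr_left fun x => by ring

lemma isBigO_poly (c₀ c₁ c₂ c₃ : ℝ) :
    (fun h : ℝ => c₀ + c₁ * h + c₂ * h ^ 2 + c₃ * h ^ 3) =O[𝓝[>] 0] fun _ => (1 : ℝ) := by
  have : Continuous fun h : ℝ => c₀ + c₁ * h + c₂ * h ^ 2 + c₃ * h ^ 3 := by fun_prop
  exact ((this.tendsto 0).mono_left nhdsWithin_le_nhds).isBigO_one ℝ

lemma isBigO_one (hg : RightJet n g a₀ a₁ a₂ a₃) : g =O[𝓝[>] 0] fun _ => (1 : ℝ) := by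
  have h₁ : (fun x : ℝ => x ^ n) =O[𝓝[>] 0] fun _ => (1 : ℝ) := by
    simpa using isBigO_pow_nhdsGT_zero (Nat.zero_le n)
  exact ((IsBigO.trans hg h₁).add (isBigO_poly a₀ a₁ a₂ a₃)).congr_left fun x => by ring

lemma mul (hn : n ≤ 4) (hg : RightJet n g a₀ a₁ a₂ a₃) (hk : RightJet n k b₀ b₁ b₂ b₃) :
    RightJet n (fun h => g h * k h) (a₀ * b₀) (a₀ * b₁ + a₁ * b₀)
      (a₀ * b₂ + a₁ * b₁ + a₂ * b₀) (a₀ * b₃ + a₁ * b₂ + a₂ * b₁ + a₃ * b₀) := by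
  have h₁ := IsBigO.mul hg hk.isBigO_one
  have h₂ := (isBigO_poly a₀ a₁ a₂ a₃).mul hk
  have h₃ := (isBigO_poly (a₁ * b₃ + a₂ * b₂ + a₃ * b₁) (a₂ * b₃ + a₃ * b₂) (a₃ * b₃) 0).mul
    (isBigO_pow_nhdsGT_zero hn)
  simp only [mul_one, one_mul] at h₁ h₂ h₃
  exact ((h₁.add h₂).add h₃).congr_left fun x => by ring

lemma isBigO_id (hn : 1 ≤ n) (hg : RightJet n g 0 a₁ a₂ a₃) :
    g =O[𝓝[>] 0] fun h : ℝ => h := by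
  have h₁ : (fun x : ℝ => x ^ n) =O[𝓝[>] 0] fun x : ℝ => x := by
    simpa using isBigO_pow_nhdsGT_zero hn
  have h₂ := (isBigO_poly a₁ a₂ a₃ 0).mul (isBigO_refl (fun x : ℝ => x) (𝓝[>] 0))
  simp only [one_mul] at h₂
  exact ((IsBigO.trans hg h₁).add h₂).congr_left fun x => by ring

/-- Composition of a smooth function of two variables with a curve. -/
lemma comp {f : ℝ × ℝ → ℝ} (hf : ContDiff ℝ (⊤ : ℕ∞) f) (t v c : ℝ) (hn : 1 ≤ n) (hn' : n ≤ 4)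
    (hk : RightJet n k 0 b₁ b₂ b₃) :
    RightJet n (fun h => f (t + c * h, v + k h)) (f (t, v))
      (pd f (1, 0) (t, v) * c + pd f (0, 1) (t, v) * b₁)
      (pd f (0, 1) (t, v) * b₂ + (pd (pd f (1, 0)) (1, 0) (t, v) * c ^ 2 +
        2 * pd (pd f (1, 0)) (0, 1) (t, v) * (c * b₁) +
        pd (pd f (0, 1)) (0, 1) (t, v) * b₁ ^ 2) / 2)
      (pd f (0, 1) (t, v) * b₃ + pd (pd f (1, 0)) (0, 1) (t, v) * (c * b₂) +
        pd (pd f (0, 1)) (0, 1) (t, v) * (b₁ * b₂) +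
        (pd (pd (pd f (1, 0)) (1, 0)) (1, 0) (t, v) * c ^ 3 +
          3 * pd (pd (pd f (1, 0)) (1, 0)) (0, 1) (t, v) * (c ^ 2 * b₁) +
          3 * pd (pd (pd f (1, 0)) (0, 1)) (0, 1) (t, v) * (c * b₁ ^ 2) +
          pd (pd (pd f (0, 1)) (0, 1)) (0, 1) (t, v) * b₁ ^ 3) / 6) := by
  have hkO : k =O[𝓝[>] 0] fun h : ℝ => h := hk.isBigO_id hn
  have hid : Tendsto (fun h : ℝ => h) (𝓝[>] 0) (𝓝 0) := tendsto_id.mono_left nhdsWithin_le_nhds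
  have hlim : Tendsto (fun h => (t + c * h, v + k h)) (𝓝[>] 0) (𝓝 (t, v)) := by
    refine Tendsto.prodMk_nhds ?_ ?_
    · simpa using (hid.const_mul c).const_add t
    · simpa using (hkO.trans_tendsto hid).const_add v
  have hsub : (fun h => (t + c * h, v + k h) - (t, v)) =O[𝓝[>] 0] fun h : ℝ => h := by
    have := ((isBigO_refl (fun h : ℝ => h) (𝓝[>] 0)).const_mul_left c).prod_left hkO
    exact this.congr_left fun h => by simp
  have hT : (_ : ℝ → ℝ) =O[𝓝[>] 0] _ :=
    (((isBigO_sub_taylor_three hf (t, v)).comp_tendsto hlim).trans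
      (hsub.norm_left.pow 4)).trans (isBigO_pow_nhdsGT_zero hn')
  have hx := linear n c
  have hx2 := hx.mul hn' hx
  have hxk := hx.mul hn' hk
  have hk2 := hk.mul hn' hk
  have hP := ((((((((((const n (f (t, v))).add (hx.const_mul (pd f (1, 0) (t, v)))).add
    (hk.const_mul (pd f (0, 1) (t, v)))).add
    (hx2.const_mul (pd (pd f (1, 0)) (1, 0) (t, v) / 2))).add
    (hxk.const_mul (pd (pd f (1, 0)) (0, 1) (t, v)))).add
    (hk2.const_mul (pd (pd f (0, 1)) (0, 1) (t, v) / 2))).add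
    ((hx2.mul hn' hx).const_mul (pd (pd (pd f (1, 0)) (1, 0)) (1, 0) (t, v) / 6))).add
    ((hx2.mul hn' hk).const_mul (pd (pd (pd f (1, 0)) (1, 0)) (0, 1) (t, v) / 2))).add
    ((hxk.mul hn' hk).const_mul (pd (pd (pd f (1, 0)) (0, 1)) (0, 1) (t, v) / 2))).add
    ((hk2.mul hn' hk).const_mul (pd (pd (pd f (0, 1)) (0, 1)) (0, 1) (t, v) / 6)))
  refine (hT.add hP).congr_left fun h => ?_
  simp only [Function.comp_apply, add_sub_cancel_left]
  ring

/-- Integration: the difference quotient of a primitive. -/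
lemma div_of_hasDerivAt {δ : ℝ} (hδ : 0 < δ) (hg₀ : g 0 = 0)
    (hcont : ∀ x ∈ Set.Icc 0 δ, ContinuousWithinAt g (Set.Icc 0 δ) x)
    (hder : ∀ x ∈ Set.Ioo 0 δ, HasDerivAt g (k x) x) (hk : RightJet n k a₀ a₁ a₂ a₃) :
    RightJet n (fun h => g h / h) a₀ (a₁ / 2) (a₂ / 3) (a₃ / 4) := by
  obtain ⟨C, hC, hb⟩ := IsBigO.exists_pos hk
  obtain ⟨r, hr, hb⟩ := mem_nhdsGT_iff_exists_Ioo_subset.1 hb.bound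
  refine IsBigO.of_bound C ?_
  filter_upwards [Ioo_mem_nhdsGT (lt_min hδ hr)] with h ⟨hh, hlt⟩
  have hhδ : h < δ := hlt.trans_le (min_le_left _ _)
  obtain ⟨x, hx, hslope⟩ := exists_hasDerivAt_eq_slope
    (fun s => g s - (a₀ * s + a₁ * s ^ 2 / 2 + a₂ * s ^ 3 / 3 + a₃ * s ^ 4 / 4))
    (fun s => k s - (a₀ + a₁ * s + a₂ * s ^ 2 + a₃ * s ^ 3)) hh
    (ContinuousOn.sub (fun s hs => (hcont s ⟨hs.1, hs.2.trans hhδ.le⟩).mono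
      (Set.Icc_subset_Icc_right hhδ.le)) (by fun_prop))
    (fun s hs => by
      refine (hder s ⟨hs.1, hs.2.trans hhδ⟩).sub ?_
      have hp := ((((hasDerivAt_id s).const_mul a₀).add
        (((hasDerivAt_pow 2 s).const_mul a₁).div_const 2)).add
        (((hasDerivAt_pow 3 s).const_mul a₂).div_const 3)).add
        (((hasDerivAt_pow 4 s).const_mul a₃).div_const 4)
      refine hp.congr_deriv ?_
      push_cast
      ring)
  have hbx : ‖k x - (a₀ + a₁ * x + a₂ * x ^ 2 + a₃ * x ^ 3)‖ ≤ C * ‖x ^ n‖ :=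
    hb ⟨hx.1, (hx.2.trans hlt).trans_le (min_le_right _ _)⟩
  rw [hslope, hg₀] at hbx
  have hle : C * ‖x ^ n‖ ≤ C * ‖h ^ n‖ := by
    rw [norm_pow, norm_pow, Real.norm_of_nonneg hx.1.le, Real.norm_of_nonneg hh.le]
    have := hx.1.le
    have := hx.2.le
    gcongr
  refine le_trans (le_of_eq ?_) (hbx.trans hle)
  congr 1
  field_simp
  ring

lemma of_div (hn : n ≤ 3) (hg : RightJet n (fun h => g h / h) a₀ a₁ a₂ a₃) :
    RightJet (n + 1) g 0 a₀ a₁ a₂ := by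
  have h₁ := IsBigO.mul hg (isBigO_refl (fun x : ℝ => x) (𝓝[>] 0))
  have h₂ := (isBigO_pow_nhdsGT_zero (show n + 1 ≤ 4 by omega)).const_mul_left a₃
  refine IsBigO.congr' (h₁.add h₂) ?_ (.of_forall fun x => (pow_succ x n).symm)
  filter_upwards [self_mem_nhdsWithin] with x hx
  have : x ≠ 0 := ne_of_gt hx
  field_simp
  ring

lemma sqrt_one_add (e : ℝ) :
    RightJet 4 (fun h => √(1 + e * h ^ 2)) 1 0 (e / 2) 0 := by
  refine IsBigO.of_bound (e ^ 2) ?_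
  have hc : Continuous fun h : ℝ => 1 + e * h ^ 2 := by fun_prop
  have hpos : ∀ᶠ h in 𝓝[>] (0 : ℝ), 0 < 1 + e * h ^ 2 :=
    nhdsWithin_le_nhds (hc.continuousAt.eventually (lt_mem_nhds (by simp)))
  filter_upwards [hpos] with h hh
  have hs := Real.sq_sqrt hh.le
  have hs₀ := Real.sqrt_nonneg (1 + e * h ^ 2)
  set s := √(1 + e * h ^ 2)
  have h₁ : s - (1 + 0 * h + e / 2 * h ^ 2 + 0 * h ^ 3) = -((s - 1) ^ 2 / 2) := by
    linarith
  have h₂ : (s - 1) ^ 2 ≤ (e * h ^ 2) ^ 2 := by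
    have h₃ : e * h ^ 2 = (s - 1) * (s + 1) := by linarith
    rw [h₃, mul_pow]
    nlinarith [sq_nonneg (s - 1), mul_nonneg (sq_nonneg (s - 1)) hs₀,
      mul_nonneg (mul_nonneg (sq_nonneg (s - 1)) hs₀) hs₀]
  rw [h₁, norm_neg, Real.norm_of_nonneg (by positivity), Real.norm_of_nonneg (by positivity)]
  nlinarith [sq_nonneg (s - 1)]

lemma inv_sqrt_one_add (e : ℝ) :
    RightJet 4 (fun h => (√(1 + e * h ^ 2))⁻¹) 1 0 (-e / 2) 0 := by
  have hs := sqrt_one_add e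
  have hc : Continuous fun h : ℝ => √(1 + e * h ^ 2) := by fun_prop
  have hlim : Tendsto (fun h : ℝ => √(1 + e * h ^ 2)) (𝓝[>] 0) (𝓝 1) := by
    simpa using (hc.tendsto 0).mono_left nhdsWithin_le_nhds
  have hinv : (fun h : ℝ => (√(1 + e * h ^ 2))⁻¹) =O[𝓝[>] 0] fun _ => (1 : ℝ) :=
    (hlim.inv₀ one_ne_zero).isBigO_one ℝ
  have hnum : RightJet 4 (fun h => 1 + √(1 + e * h ^ 2) *
      (-1 + 0 * h + e / 2 * h ^ 2 + 0 * h ^ 3)) 0 0 0 0 :=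
    ((const 4 1).add (hs.mul le_rfl (poly 4 (-1) 0 (e / 2) 0))).congr_coeff
      (by ring) (by ring) (by ring) (by ring)
  have hprod := IsBigO.mul hnum hinv
  simp only [mul_one] at hprod
  refine IsBigO.congr' hprod ?_ EventuallyEq.rfl
  filter_upwards [hlim.eventually (lt_mem_nhds one_pos)] with h hh
  have := hh.ne'
  field_simp
  ring

end RightJet

/-- The Taylor expansion of the difference quotient of a solution of `u' = f(t, u)`. -/
lemma rightJet_slope_of_ode {f : ℝ × ℝ → ℝ} (hf : ContDiff ℝ (⊤ : ℕ∞) f) {u : ℝ → ℝ} {a b t : ℝ}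
    (hode : ∀ s ∈ Set.Icc a b, HasDerivWithinAt u (f (s, u s)) (Set.Icc a b) s)
    (ht : t ∈ Set.Ico a b) {F p q r s w A B D : ℝ} (hF : F = f (t, u t))
    (hp : p = pd f (1, 0) (t, u t)) (hq : q = pd f (0, 1) (t, u t))
    (hr : r = pd (pd f (1, 0)) (1, 0) (t, u t)) (hs : s = pd (pd f (1, 0)) (0, 1) (t, u t))
    (hw : w = pd (pd f (0, 1)) (0, 1) (t, u t)) (hA : A = p + q * F)
    (hB : B = q * A / 2 + (r + 2 * s * F + w * F ^ 2) / 2)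
    (hD : D = q * B / 3 + s * A / 2 + w * F * A / 2 +
      (pd (pd (pd f (1, 0)) (1, 0)) (1, 0) (t, u t) +
        3 * pd (pd (pd f (1, 0)) (1, 0)) (0, 1) (t, u t) * F +
        3 * pd (pd (pd f (1, 0)) (0, 1)) (0, 1) (t, u t) * F ^ 2 +
        pd (pd (pd f (0, 1)) (0, 1)) (0, 1) (t, u t) * F ^ 3) / 6) :
    RightJet 4 (fun h => (u (t + h) - u t) / h) F (A / 2) (B / 3) (D / 4) := by
  set y : ℝ → ℝ := fun h => u (t + h) - u t with hy
  have hδ : 0 < b - t := sub_pos.2 ht.2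
  have hmaps : Set.MapsTo (fun h => t + h) (Set.Icc 0 (b - t)) (Set.Icc a b) := fun h hh =>
    ⟨by linarith [hh.1, ht.1], by linarith [hh.2]⟩
  have hyw : ∀ h ∈ Set.Icc 0 (b - t),
      HasDerivWithinAt y (f (t + h, u (t + h))) (Set.Icc 0 (b - t)) h := by
    intro h hh
    have := (hode (t + h) (hmaps hh)).comp h ((hasDerivAt_id h).const_add t).hasDerivWithinAt hmaps
    exact (this.congr_deriv (mul_one _)).sub_const (u t)
  have hy₀ : y 0 = 0 := by simp [hy]
  have hstep : ∀ {n : ℕ} {c₀ c₁ c₂ c₃ : ℝ},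
      RightJet n (fun h => f (t + 1 * h, u t + y h)) c₀ c₁ c₂ c₃ →
      RightJet n (fun h => y h / h) c₀ (c₁ / 2) (c₂ / 3) (c₃ / 4) := by
    intro n c₀ c₁ c₂ c₃ h
    refine h.div_of_hasDerivAt hδ hy₀ (fun x hx => (hyw x hx).continuousWithinAt) fun x hx => ?_
    simpa [hy] using (hyw x (Set.Ioo_subset_Icc_self hx)).hasDerivAt (Icc_mem_nhds hx.1 hx.2)
  have y₁ : RightJet 1 y 0 0 0 0 := by
    have := (hyw 0 ⟨le_rfl, hδ.le⟩).differentiableWithinAt.isBigO_sub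
    have hle : 𝓝[>] (0 : ℝ) ≤ 𝓝[Set.Icc 0 (b - t)] 0 := by
      rw [← nhdsWithin_Ioo_eq_nhdsGT hδ]
      exact nhdsWithin_mono _ Set.Ioo_subset_Icc_self
    simpa [RightJet, hy₀] using this.mono hle
  have y₂ : RightJet 2 y 0 F 0 0 :=
    (hstep ((y₁.comp hf t (u t) 1 le_rfl (by norm_num)).congr_of_le (b₁ := 0) (b₂ := 0) (b₃ := 0)
      (by norm_num) (by norm_num) (by norm_num))).of_div (by norm_num) |>.congr_coeff
      rfl hF.symm (by norm_num) (by norm_num)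
  have y₃ : RightJet 3 y 0 F (A / 2) 0 :=
    (hstep ((y₂.comp hf t (u t) 1 (by norm_num) (by norm_num)).congr_of_le (b₁ := A) (b₂ := 0)
      (b₃ := 0) (.inr (by rw [hA, hp, hq]; ring)) (by norm_num) (by norm_num))).of_div
      (by norm_num) |>.congr_coeff rfl hF.symm rfl (by norm_num)
  have y₄ : RightJet 4 y 0 F (A / 2) (B / 3) :=
    (hstep ((y₃.comp hf t (u t) 1 (by norm_num) (by norm_num)).congr_of_le (b₁ := A) (b₂ := B)
      (b₃ := 0) (.inr (by rw [hA, hp, hq]; ring))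
      (.inr (by rw [hB, hq, hr, hs, hw]; ring)) (by norm_num))).of_div
      (by norm_num) |>.congr_coeff rfl hF.symm rfl rfl
  exact hstep ((y₄.comp hf t (u t) 1 (by norm_num) le_rfl).congr_coeff (b₁ := A) (b₂ := B)
    (b₃ := D) hF.symm (by rw [hA, hp, hq]; ring) (by rw [hB, hq, hr, hs, hw]; ring)
    (by rw [hD, hq, hs, hw]; ring))

/-- The Taylor expansion of the increment of an IMQ-RBF stage. -/
lemma RightJet.imq_stage {K : ℝ → ℝ} {κ₀ κ₁ κ₂ κ₃ : ℝ} (hK : RightJet 4 K κ₀ κ₁ κ₂ κ₃)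
    (v e c : ℝ) :
    RightJet 4 (fun h => √(1 + e * c ^ 2 * h ^ 2) * (h * K h) + v / √(1 + e * c ^ 2 * h ^ 2) - v)
      0 κ₀ (κ₁ - v * e * c ^ 2 / 2) (κ₂ + e * c ^ 2 / 2 * κ₀) := by
  have hsq := sqrt_one_add (e * c ^ 2)
  have hinv := inv_sqrt_one_add (e * c ^ 2)
  have h := ((hsq.mul le_rfl ((linear 4 1).mul le_rfl hK)).add (hinv.const_mul v)).add
    (RightJet.const 4 (-v))
  refine (h.congr_fun (.of_forall fun x => ?_)).congr_coeff ?_ ?_ ?_ ?_ <;> ring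

/-- Fourth-order accuracy of the three-stage IMQ-RBF Runge–Kutta method (case III):
`a₂₁ = c₂ = 1`, `a₃₁ = 1/4`, `a₃₂ = 1/4`, `c₃ = 1/2`, `b₁ = 1/6`, `b₂ = 1/6`,
`b₃ = 2/3`, shape parameters
`ε₂² = (−f f_t f_uu − f f_u³ + f f_u f_tu − f_t f_u² − f_t f_tu + f_tt f_u)
      /(v f f_uu + 2v f_u² + v f_tu − f f_u)` and `ε₃² = −ε₂²` (denominator nonzero);
then the local truncation error is `O(h⁴)` as `h → 0⁺`. -/
theorem imq_rk3_fourth_order_III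
    (a b : ℝ) (hab : a < b) (f : ℝ × ℝ → ℝ) (hf : ContDiff ℝ (⊤ : ℕ∞) f)
    (u : ℝ → ℝ) (hu : ContDiffOn ℝ (⊤ : ℕ∞) u (Set.Icc a b))
    (hode : ∀ s ∈ Set.Icc a b, HasDerivWithinAt u (f (s, u s)) (Set.Icc a b) s)
    (t : ℝ) (ht : t ∈ Set.Ico a b) :
    let v := u t
    let F := f (t, v)
    let ft := pd f (1, 0) (t, v)
    let fu := pd f (0, 1) (t, v)
    let ftt := pd (pd f (1, 0)) (1, 0) (t, v)
    let ftu := pd (pd f (1, 0)) (0, 1) (t, v)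
    let fuu := pd (pd f (0, 1)) (0, 1) (t, v)
    let den := v * F * fuu + 2 * v * fu ^ 2 + v * ftu - F * fu
    let eps2 := (-F * ft * fuu - F * fu ^ 3 + F * fu * ftu - ft * fu ^ 2 -
      ft * ftu + ftt * fu) / den
    let eps3 := -eps2
    den ≠ 0 →
    ∃ C > 0, ∃ h₀ > 0, ∀ h : ℝ, 0 < h → h ≤ h₀ →
      let k1 := F
      let k2 := f (t + 1 * h,
        Real.sqrt (1 + eps2 * 1 ^ 2 * h ^ 2) * (h * 1 * k1) +
          v / Real.sqrt (1 + eps2 * 1 ^ 2 * h ^ 2))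
      let k3 := f (t + (1 / 2) * h,
        Real.sqrt (1 + eps3 * (1 / 2) ^ 2 * h ^ 2) * (h * ((1 / 4) * k1 + (1 / 4) * k2)) +
          v / Real.sqrt (1 + eps3 * (1 / 2) ^ 2 * h ^ 2))
      |(u (t + h) - u t) / h - ((1 / 6) * k1 + (1 / 6) * k2 + (2 / 3) * k3)| ≤
        C * h ^ 4 := by
  intro v F ft fu ftt ftu fuu den eps2 eps3 hden
  have hslope := rightJet_slope_of_ode hf hode ht (F := F) (p := ft) (q := fu) (r := ftt)
    (s := ftu) (w := fuu) rfl rfl rfl rfl rfl rfl rfl rfl rfl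
  have hk₂ := ((RightJet.const 4 (1 * F)).imq_stage v eps2 1).comp hf t v 1 (by norm_num) le_rfl
  have hK₃ := (RightJet.const 4 (1 / 4 * F)).add (hk₂.const_mul (1 / 4))
  have hk₃ := (hK₃.imq_stage v eps3 (1 / 2)).comp hf t v (1 / 2) (by norm_num) le_rfl
  have hτ := hslope.add ((((RightJet.const 4 (1 / 6 * F)).add (hk₂.const_mul (1 / 6))).add
    (hk₃.const_mul (2 / 3))).const_mul (-1))
  have heps : eps2 * (v * F * fuu + 2 * v * fu ^ 2 + v * ftu - F * fu) =
      -F * ft * fuu - F * fu ^ 3 + F * fu * ftu - ft * fu ^ 2 - ft * ftu + ftt * fu :=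
    div_mul_cancel₀ _ hden
  have hv : u t = v := rfl
  have hF : f (t, v) = F := rfl
  have hft : pd f (1, 0) (t, v) = ft := rfl
  have hfu : pd f (0, 1) (t, v) = fu := rfl
  have hftt : pd (pd f (1, 0)) (1, 0) (t, v) = ftt := rfl
  have hftu : pd (pd f (1, 0)) (0, 1) (t, v) = ftu := rfl
  have hfuu : pd (pd f (0, 1)) (0, 1) (t, v) = fuu := rfl
  have heps3 : eps3 = -eps2 := rfl
  simp only [hv, hF, hft, hfu, hftt, hftu, hfuu, heps3] at hτ
  replace hτ := hτ.congr_coeff (b₀ := 0) (b₁ := 0) (b₂ := 0) (b₃ := 0) (by ring) (by ring)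
    (by ring) (by linear_combination (1 / 24) * heps)
  obtain ⟨C, hC, hb⟩ := IsBigO.exists_pos hτ
  obtain ⟨h₀, hh₀, hb⟩ := mem_nhdsGT_iff_exists_Ioc_subset.1 hb.bound
  refine ⟨C, hC, h₀, hh₀, fun h hpos hle => ?_⟩
  intro k1 k2 k3
  have hbh := hb ⟨hpos, hle⟩
  simp only [Set.mem_ofPred_eq, Real.norm_eq_abs, abs_pow, abs_of_pos hpos, add_sub_cancel] at hbh
  convert hbh using 2
  simp only [k1, k2, k3, hv, heps3]
  ring_nf
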